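/- arXiv:2401.17357 — 8 statements merged into one kernel-verified Lean document; each statement's English description precedes it below -/
import Mathlib

section
/- Let H be a finite-dimensional complex inner product space, U a unitary operator on H, λ ∈ ℂ, and let ψ₁,…,ψ_n ∈ H be finitely many (not necessarily orthogonal or normalized) vectors. Set ρ = Σ_{i=1}^n |ψ_i⟩⟨ψ_i|. Then U ψ_i = λ ψ_i for all i if and only if U ρ = λ ρ. -/
open Matrix

/-- The rank-one operator `|ψ⟩⟨ψ| : v ↦ ⟨ψ, v⟩ ψ`, as a matrix. -/
noncomputable def outer {ι : Type*} [Fintype ι] (ψ : ι → ℂ) : Matrix ι ι ℂ :=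
  Matrix.of fun i j => ψ i * (starRingEnd ℂ) (ψ j)

/-- A sum of rank-one operators is the Gram-type product `Ψ Ψᴴ`, where the columns of `Ψ` are
the given vectors. -/
lemma sum_outer_eq_mul_conjTranspose {ι κ : Type*} [Fintype ι] [Fintype κ] (ψ : κ → ι → ℂ) :
    ∑ i, outer (ψ i) = (Matrix.of ψ)ᵀ * (Matrix.of ψ)ᵀᴴ := by
  ext a b
  simp [outer, Matrix.sum_apply, Matrix.mul_apply]

open scoped ComplexOrder in
/-- Left multiplications by `U` and by a scalar agree on `A Aᴴ` exactly when they agree on `A`. -/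
lemma mul_self_mul_conjTranspose_eq_smul_iff {ι κ : Type*} [Fintype ι] [DecidableEq ι] [Fintype κ]
    (U : Matrix ι ι ℂ) (c : ℂ) (A : Matrix ι κ ℂ) :
    U * (A * Aᴴ) = c • (A * Aᴴ) ↔ U * A = c • A := by
  have h := Matrix.mul_self_mul_conjTranspose_eq_zero A (U - c • (1 : Matrix ι ι ℂ))
  rwa [Matrix.sub_mul, Matrix.sub_mul, Matrix.smul_mul, Matrix.smul_mul, Matrix.one_mul,
    Matrix.one_mul, sub_eq_zero, sub_eq_zero] at h

/-- A strongly symmetric mixed state `ρ = Σ_i |ψ_i⟩⟨ψ_i|` (with charge `λ`) has all vectors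
in the decomposition eigenvectors of `U` with eigenvalue `λ`, and conversely. -/
theorem strongly_symmetric_iff_all_vectors_symmetric
    {ι : Type*} [Fintype ι] [DecidableEq ι]
    (U : Matrix ι ι ℂ) (hU : U ∈ Matrix.unitaryGroup ι ℂ)
    (lam : ℂ) (n : ℕ) (ψ : Fin n → ι → ℂ) :
    (∀ i, U.mulVec (ψ i) = lam • ψ i) ↔
      U * (∑ i, outer (ψ i)) = lam • ∑ i, outer (ψ i) := by
  have columns : (∀ i, U.mulVec (ψ i) = lam • ψ i) ↔
      U * (Matrix.of ψ)ᵀ = lam • (Matrix.of ψ)ᵀ := by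
    simp only [funext_iff, ← Matrix.ext_iff]
    exact forall_comm
  rw [columns, sum_outer_eq_mul_conjTranspose, mul_self_mul_conjTranspose_eq_smul_iff]
end

section
/- Let G be a group, H_L and H_R finite-dimensional complex inner product spaces, U_L : G → (unitaries on H_L) a projective representation with 2-cocycle ω_L (i.e., U_L(g)U_L(h) = ω_L(g,h) U_L(gh) with ω_L : G × G → ℂ∖{0}), and U_R : G → (unitaries on H_R) arbitrary. If there exist nonzero vectors a ∈ H_L, b ∈ H_R and λ : G → ℂ with (U_L(g) ⊗ U_R(g))(a ⊗ b) = λ(g) (a ⊗ b) for all g ∈ G, then ω_L is a 2-coboundary: there exists μ : G → ℂ∖{0} with ω_L(g,h) = μ(g)μ(h)/μ(gh) for all g, h ∈ G. Equivalently, if ω_L is not a 2-coboundary, every nonzero simultaneous eigenvector of all U_L(g) ⊗ U_R(g) is entangled (not a simple tensor). -/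
open Matrix Kronecker

namespace Matrix

variable {R ι κ : Type*}

theorem mulVec_ne_zero_of_mem_unitaryGroup [Fintype ι] [DecidableEq ι] [CommRing R] [StarRing R]
    {U : Matrix ι ι R} (hU : U ∈ unitaryGroup ι R) {v : ι → R} (hv : v ≠ 0) : U *ᵥ v ≠ 0 := by
  intro h
  apply hv
  rw [← one_mulVec v, ← mem_unitaryGroup_iff'.mp hU, ← mulVec_mulVec, h, mulVec_zero]

theorem kronecker_mulVec_mul [Fintype ι] [Fintype κ] [CommSemiring R]
    (A : Matrix ι ι R) (B : Matrix κ κ R) (a : ι → R) (b : κ → R) (i : ι) (j : κ) :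
    ((A ⊗ₖ B) *ᵥ fun p : ι × κ => a p.1 * b p.2) (i, j) = (A *ᵥ a) i * (B *ᵥ b) j := by
  simp only [mulVec, dotProduct, kronecker_apply, Fintype.sum_prod_type, Finset.sum_mul_sum]
  exact Finset.sum_congr rfl fun _ _ => Finset.sum_congr rfl fun _ _ => mul_mul_mul_comm ..

/-- If a simple tensor `a ⊗ b` is an eigenvector of `A ⊗ B` and `B b ≠ 0`, then `a` is an
eigenvector of `A`. -/
theorem exists_mulVec_eq_smul_of_kronecker [Fintype ι] [Fintype κ] [Field R]
    {A : Matrix ι ι R} {B : Matrix κ κ R} {a : ι → R} {b : κ → R} {r : R} (hB : B *ᵥ b ≠ 0)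
    (h : (A ⊗ₖ B) *ᵥ (fun p : ι × κ => a p.1 * b p.2) = r • fun p : ι × κ => a p.1 * b p.2) :
    ∃ c : R, A *ᵥ a = c • a := by
  obtain ⟨j, hj⟩ := Function.ne_iff.mp hB
  rw [Pi.zero_apply] at hj
  refine ⟨r * b j / (B *ᵥ b) j, funext fun i => ?_⟩
  have hij := congrFun h (i, j)
  rw [kronecker_mulVec_mul, Pi.smul_apply, smul_eq_mul] at hij
  rw [Pi.smul_apply, smul_eq_mul, div_mul_eq_mul_div, eq_div_iff hj, hij]
  ring

end Matrix

/-- If `U_L : G → U(H_L)` is a projective representation with 2-cocycle `ω_L`,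
`U_R(g)` are arbitrary unitaries on `H_R`, and some nonzero simple tensor `a ⊗ b`
is a simultaneous eigenvector of all `U_L(g) ⊗ U_R(g)`, then `ω_L` is a 2-coboundary. -/
theorem cocycle_is_coboundary_of_separable_eigenvector
    {G : Type*} [Group G] {ι κ : Type*}
    [Fintype ι] [DecidableEq ι] [Fintype κ] [DecidableEq κ]
    (UL : G → Matrix ι ι ℂ) (hUL : ∀ g, UL g ∈ Matrix.unitaryGroup ι ℂ)
    (ωL : G → G → ℂ) (hωL : ∀ g h, ωL g h ≠ 0)
    (hrep : ∀ g h, UL g * UL h = ωL g h • UL (g * h))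
    (UR : G → Matrix κ κ ℂ) (hUR : ∀ g, UR g ∈ Matrix.unitaryGroup κ ℂ)
    (a : ι → ℂ) (b : κ → ℂ) (ha : a ≠ 0) (hb : b ≠ 0) (lam : G → ℂ)
    (heig : ∀ g, (UL g ⊗ₖ UR g).mulVec (fun p : ι × κ => a p.1 * b p.2)
      = lam g • (fun p : ι × κ => a p.1 * b p.2)) :
    ∃ μ : G → ℂ, (∀ g, μ g ≠ 0) ∧ ∀ g h, ωL g h = μ g * μ h / μ (g * h) := by
  have hc : ∀ g, ∃ c : ℂ, UL g *ᵥ a = c • a := fun g =>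
    exists_mulVec_eq_smul_of_kronecker (mulVec_ne_zero_of_mem_unitaryGroup (hUR g) hb) (heig g)
  choose μ hμ using hc
  have hμ0 : ∀ g, μ g ≠ 0 := fun g h0 =>
    mulVec_ne_zero_of_mem_unitaryGroup (hUL g) ha (by rw [hμ, h0, zero_smul])
  refine ⟨μ, hμ0, fun g h => ?_⟩
  have key := congrArg (· *ᵥ a) (hrep g h)
  simp only [← mulVec_mulVec, smul_mulVec, hμ, mulVec_smul, smul_smul] at key
  rw [eq_div_iff (hμ0 _), ← smul_left_injective ℂ ha key, mul_comm]
end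

section
/- Let L ≥ 2 be even, 1 ≤ N_A ≤ L−1, and set A = {0,…,N_A−1}, B = {N_A,…,L−1} ⊂ ZMod L. Given bit strings α on A and β on B and nonzero s, t ∈ ℂ, define the cat product state ψ(b) = (1/2)·(1_{b|_A=α} + s·1_{b|_A=¬α})·(1_{b|_B=β} + t·1_{b|_B=¬β}). Then ψ is an eigenvector of U_CZX if and only if s² = t² = (−1)^{N_A + 1 + α_0 + α_{N_A−1} + β_{N_A} + β_{L−1}} (bits read as integers 0 or 1), and in that case U_CZX ψ = λ ψ with λ = s·t·(−1)^{Σ_{i∈ZMod L} γ_i γ_{i+1}}, where γ is the bit string on ZMod L obtained by concatenating α and β (γ|_A = α, γ|_B = β). -/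
open Matrix

/-- The CZX operator on a periodic chain of `L` qubits:
`U_CZX |b⟩ = (−1)^{Σ_i b_i b_{i+1}} |¬b⟩`. -/
noncomputable def czxMatrix (L : ℕ) [NeZero L] :
    Matrix (ZMod L → Bool) (ZMod L → Bool) ℂ :=
  Matrix.of fun b b' =>
    if b = (fun i => ! b' i) then
      ∏ i : ZMod L, (if b' i && b' (i + 1) then (-1 : ℂ) else 1)
    else 0

/-- The diagonal phase `(−1)^{Σ_i b_i b_{i+1}}` of the CZX operator. -/
noncomputable def czxPhase {L : ℕ} [NeZero L] (b : ZMod L → Bool) : ℂ :=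
  ∏ i : ZMod L, (if b i && b (i + 1) then (-1 : ℂ) else 1)

theorem prod_zmod_eq_prod_range {M : Type*} [CommMonoid M] (L : ℕ) [NeZero L] (f : ZMod L → M) :
    ∏ i : ZMod L, f i = ∏ k ∈ Finset.range L, f (k : ZMod L) := by
  refine Finset.prod_bij' (fun i _ => i.val) (fun k _ => (k : ZMod L)) ?_ ?_ ?_ ?_ ?_
  · intro i _
    exact Finset.mem_range.2 (ZMod.val_lt i)
  · simp
  · intro i _
    exact ZMod.natCast_rightInverse i
  · intro k hk
    exact ZMod.val_cast_of_lt (Finset.mem_range.1 hk)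
  · intro i _
    rw [ZMod.natCast_rightInverse i]

theorem czxPhase_mul_self {L : ℕ} [NeZero L] (b : ZMod L → Bool) :
    czxPhase b * czxPhase b = 1 := by
  rw [czxPhase, ← Finset.prod_mul_distrib]
  refine Finset.prod_eq_one fun i _ => ?_
  split_ifs <;> norm_num

theorem czxPhase_compl {L : ℕ} [NeZero L] (hL : Even L) (b : ZMod L → Bool) :
    czxPhase (fun i => !b i) = czxPhase b := by
  have h : ∀ i : ZMod L, (if !b i && !b (i + 1) then (-1 : ℂ) else 1)
      = (if b i && b (i + 1) then (-1 : ℂ) else 1) *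
        (-1 * ((if b i then (-1 : ℂ) else 1) * (if b (i + 1) then (-1 : ℂ) else 1))) := by
    intro i
    cases b i <;> cases b (i + 1) <;> norm_num
  have hshift : ∏ i : ZMod L, (if b (i + 1) then (-1 : ℂ) else 1)
      = ∏ i : ZMod L, (if b i then (-1 : ℂ) else 1) :=
    Equiv.prod_comp (Equiv.addRight (1 : ZMod L)) fun i => if b i then (-1 : ℂ) else 1
  have hsq : (∏ i : ZMod L, (if b i then (-1 : ℂ) else 1)) *
      ∏ i : ZMod L, (if b i then (-1 : ℂ) else 1) = 1 := by
    rw [← Finset.prod_mul_distrib]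
    refine Finset.prod_eq_one fun i _ => ?_
    split_ifs <;> norm_num
  unfold czxPhase
  rw [Finset.prod_congr rfl fun i _ => h i, Finset.prod_mul_distrib, Finset.prod_mul_distrib,
    Finset.prod_mul_distrib, hshift, hsq]
  simp [ZMod.card, hL.neg_one_pow]

theorem czxMatrix_mulVec_apply {L : ℕ} [NeZero L] (hL : Even L) (ψ : (ZMod L → Bool) → ℂ)
    (b : ZMod L → Bool) :
    (czxMatrix L).mulVec ψ b = czxPhase b * ψ (fun i => !b i) := by
  rw [← czxPhase_compl hL b, Matrix.mulVec, dotProduct, Finset.sum_eq_single fun i => !b i]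
  · simp [czxMatrix, czxPhase]
  · intro b' _ hb'
    have : b ≠ fun i => !b' i := by
      rintro rfl
      simp at hb'
    simp [czxMatrix, this]
  · simp

theorem prod_range_neg_sign_mul_sign (g : ℕ → Bool) (m : ℕ) :
    ∏ j ∈ Finset.range m,
        (-((if g j then (-1 : ℂ) else 1) * (if g (j + 1) then (-1 : ℂ) else 1)))
      = (-1) ^ m * ((if g 0 then (-1 : ℂ) else 1) * (if g m then (-1 : ℂ) else 1)) := by
  induction m with
  | zero => cases g 0 <;> norm_num
  | succ m ih =>
    rw [Finset.prod_range_succ, ih, pow_succ]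
    generalize (-1 : ℂ) ^ m = c
    cases g m <;> cases g 0 <;> cases g (m + 1) <;> norm_num

/-- Relative phase between a bit string and the string with the bits outside `{0, …, N_A − 1}`
flipped. -/
theorem czxPhase_mul_czxPhase_flip {L : ℕ} [NeZero L] (hL : Even L) (NA : ℕ) (hNA1 : 1 ≤ NA)
    (hNA2 : NA < L) (γ δ : ZMod L → Bool) (hlo : ∀ i : ZMod L, i.val < NA → δ i = γ i)
    (hhi : ∀ i : ZMod L, ¬ i.val < NA → δ i = !γ i) :
    czxPhase γ * czxPhase δ
      = (-1 : ℂ) ^ (NA + 1 + (if γ (0 : ZMod L) then 1 else 0)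
        + (if γ ((NA - 1 : ℕ) : ZMod L) then 1 else 0)
        + (if γ ((NA : ℕ) : ZMod L) then 1 else 0)
        + (if γ ((L - 1 : ℕ) : ZMod L) then 1 else 0)) := by
  obtain ⟨a, rfl⟩ : ∃ a, NA = a + 1 := ⟨NA - 1, by omega⟩
  obtain ⟨m, hm⟩ : ∃ m, L = a + 1 + m + 1 := ⟨L - a - 2, by omega⟩
  have hlo' : ∀ k : ℕ, k < a + 1 → δ k = γ k := fun k hk =>
    hlo _ (by rw [ZMod.val_cast_of_lt (by omega)]; exact hk)
  have hhi' : ∀ k : ℕ, a + 1 ≤ k → k < L → δ k = !γ k := fun k hk hkL =>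
    hhi _ (by rw [ZMod.val_cast_of_lt hkL]; omega)
  have h0 : δ 0 = γ 0 := by simpa using hlo' 0 (by omega)
  have hlast : ((a + 1 + m : ℕ) : ZMod L) + 1 = 0 := by
    rw [← Nat.cast_succ, Nat.succ_eq_add_one, ← hm, ZMod.natCast_self]
  have hpar : (-1 : ℂ) ^ m = (-1) ^ a := by
    have h : Even (m + a) := by
      rw [hm] at hL
      grind
    have h' := h.neg_one_pow (α := ℂ)
    rw [pow_add] at h'
    rcases neg_one_pow_eq_or ℂ m with h | h <;> rw [h] at h' ⊢
    · linear_combination -h'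
    · linear_combination h'
  have h1 : ∀ k ∈ Finset.range a,
      ((if γ (k : ZMod L) && γ ((k : ZMod L) + 1) then (-1 : ℂ) else 1) *
      (if δ (k : ZMod L) && δ ((k : ZMod L) + 1) then (-1 : ℂ) else 1)) = 1 := by
    intro k hk
    have hk := Finset.mem_range.1 hk
    rw [← Nat.cast_add_one, hlo' k (by omega), hlo' (k + 1) (by omega)]
    split_ifs <;> norm_num
  have h2 : ∀ j ∈ Finset.range m,
      ((if γ ((a + 1 + j : ℕ) : ZMod L) && γ (((a + 1 + j : ℕ) : ZMod L) + 1)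
        then (-1 : ℂ) else 1) *
      (if δ ((a + 1 + j : ℕ) : ZMod L) && δ (((a + 1 + j : ℕ) : ZMod L) + 1)
        then (-1 : ℂ) else 1))
      = -((if γ ((a + 1 + j : ℕ) : ZMod L) then (-1 : ℂ) else 1) *
          (if γ ((a + 1 + (j + 1) : ℕ) : ZMod L) then (-1 : ℂ) else 1)) := by
    intro j hj
    have hj := Finset.mem_range.1 hj
    rw [← Nat.cast_add_one, hhi' _ (by omega) (by omega), hhi' _ (by omega) (by omega),
      ← add_assoc (a + 1) j 1]
    cases γ ((a + 1 + j : ℕ) : ZMod L) <;> cases γ ((a + 1 + j + 1 : ℕ) : ZMod L) <;> norm_num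
  have hrange : Finset.range L = Finset.range (a + 1 + m + 1) := by rw [← hm]
  unfold czxPhase
  rw [← Finset.prod_mul_distrib, prod_zmod_eq_prod_range, hrange, Finset.prod_range_succ,
    Finset.prod_range_add, Finset.prod_range_succ, Finset.prod_eq_one h1,
    Finset.prod_congr rfl h2,
    prod_range_neg_sign_mul_sign fun j => γ ((a + 1 + j : ℕ) : ZMod L), hlast, hpar,
    show L - 1 = a + 1 + m by omega, Nat.add_sub_cancel, ← Nat.cast_add_one, h0,
    hlo' a (by omega), hhi' (a + 1) le_rfl hNA2, hhi' (a + 1 + m) (by omega) (by omega)]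
  simp only [add_zero, pow_add]
  generalize (-1 : ℂ) ^ a = c
  cases γ (0 : ZMod L) <;> cases γ ((a : ℕ) : ZMod L) <;> cases γ ((a + 1 : ℕ) : ZMod L) <;>
    cases γ ((a + 1 + m : ℕ) : ZMod L) <;> norm_num

/-- The cat product state `ψ = |γ|_A⟩^{(s)} ⊗ |γ|_B⟩^{(t)}` on the bipartition
`A = {x : x.val < N_A}`, `B = {x : ¬ x.val < N_A}` of `ZMod L` is an eigenvector of
`U_CZX` iff `s² = t² = (−1)^{N_A + 1 + γ_0 + γ_{N_A−1} + γ_{N_A} + γ_{L−1}}`, in which case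
the eigenvalue is `s·t·(−1)^{Σ_i γ_i γ_{i+1}}`. -/
theorem czx_cat_state_eigenvector_iff
    (L : ℕ) [NeZero L] (hL : 2 ≤ L) (hLe : Even L)
    (NA : ℕ) (hNA1 : 1 ≤ NA) (hNA2 : NA ≤ L - 1)
    (γ : ZMod L → Bool) (s t : ℂ) (hs : s ≠ 0) (ht : t ≠ 0)
    (ψ : (ZMod L → Bool) → ℂ)
    (hψ : ψ = fun b => (1 / 2 : ℂ) *
      ((if ∀ i : ZMod L, i.val < NA → b i = γ i then 1 else 0)
        + s * (if ∀ i : ZMod L, i.val < NA → b i = !(γ i) then 1 else 0)) *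
      ((if ∀ i : ZMod L, ¬ i.val < NA → b i = γ i then 1 else 0)
        + t * (if ∀ i : ZMod L, ¬ i.val < NA → b i = !(γ i) then 1 else 0)))
    (e : ℂ)
    (he : e = (-1 : ℂ) ^ (NA + 1 + (if γ (0 : ZMod L) then 1 else 0)
        + (if γ ((NA - 1 : ℕ) : ZMod L) then 1 else 0)
        + (if γ ((NA : ℕ) : ZMod L) then 1 else 0)
        + (if γ ((L - 1 : ℕ) : ZMod L) then 1 else 0))) :
    ((∃ μ : ℂ, (czxMatrix L).mulVec ψ = μ • ψ) ↔ (s ^ 2 = e ∧ t ^ 2 = e)) ∧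
      ((s ^ 2 = e ∧ t ^ 2 = e) →
        (czxMatrix L).mulVec ψ
          = (s * t * ∏ i : ZMod L, (if γ i && γ (i + 1) then (-1 : ℂ) else 1)) • ψ) := by
  have hNA : NA < L := by omega
  have hz : (0 : ZMod L).val < NA := by rw [ZMod.val_zero]; omega
  have hn : ¬ ((NA : ℕ) : ZMod L).val < NA := by rw [ZMod.val_cast_of_lt hNA]; omega
  obtain ⟨δ, hlo, hhi⟩ : ∃ δ : ZMod L → Bool, (∀ i : ZMod L, i.val < NA → δ i = γ i) ∧
      ∀ i : ZMod L, ¬ i.val < NA → δ i = !γ i :=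
    ⟨fun i => if i.val < NA then γ i else !γ i, fun i hi => if_pos hi, fun i hi => if_neg hi⟩
  have hpq : czxPhase γ * czxPhase δ = e := by
    rw [he]; exact czxPhase_mul_czxPhase_flip hLe NA hNA1 hNA γ δ hlo hhi
  have hp := czxPhase_mul_self γ
  have hq := czxPhase_mul_self δ
  have hψ₁ : ∀ b : ZMod L → Bool, ∀ x y : Bool,
      (∀ i : ZMod L, i.val < NA → b i = xor x (γ i)) →
      (∀ i : ZMod L, ¬ i.val < NA → b i = xor y (γ i)) →
      ψ b = 1 / 2 * (if x then s else 1) * (if y then t else 1) := by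
    intro b x y hx hy
    have hA : (∀ i : ZMod L, i.val < NA → b i = γ i) ↔ x = false :=
      ⟨fun h => by have := h 0 hz; rw [hx 0 hz] at this; revert this; cases x <;> simp,
        fun h i hi => by simp [hx i hi, h]⟩
    have hA' : (∀ i : ZMod L, i.val < NA → b i = !γ i) ↔ x = true :=
      ⟨fun h => by have := h 0 hz; rw [hx 0 hz] at this; revert this; cases x <;> simp,
        fun h i hi => by simp [hx i hi, h]⟩
    have hB : (∀ i : ZMod L, ¬ i.val < NA → b i = γ i) ↔ y = false :=
      ⟨fun h => by have := h _ hn; rw [hy _ hn] at this; revert this; cases y <;> simp,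
        fun h i hi => by simp [hy i hi, h]⟩
    have hB' : (∀ i : ZMod L, ¬ i.val < NA → b i = !γ i) ↔ y = true :=
      ⟨fun h => by have := h _ hn; rw [hy _ hn] at this; revert this; cases y <;> simp,
        fun h i hi => by simp [hy i hi, h]⟩
    rw [hψ]
    simp only [hA, hA', hB, hB']
    cases x <;> cases y <;> simp
  have hψγ : ψ γ = 1 / 2 := by
    simpa using hψ₁ γ false false (by simp) (by simp)
  have hψγ' : ψ (fun i => !γ i) = 1 / 2 * s * t := by
    simpa using hψ₁ (fun i => !γ i) true true (by simp) (by simp)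
  have hψδ : ψ δ = 1 / 2 * t := by
    simpa using hψ₁ δ false true (by simpa using hlo) (by simpa using hhi)
  have hψδ' : ψ (fun i => !δ i) = 1 / 2 * s := by
    simpa using hψ₁ (fun i => !δ i) true false (by simpa using hlo) (by simpa using hhi)
  have hψ₀ : ∀ b, ψ b ≠ 0 → b = γ ∨ b = (fun i => !γ i) ∨ b = δ ∨ b = fun i => !δ i := by
    intro b hb
    have hA : (∀ i : ZMod L, i.val < NA → b i = γ i) ∨
        ∀ i : ZMod L, i.val < NA → b i = !γ i := by
      by_contra h
      rw [not_or] at h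
      exact hb (by rw [hψ]; simp only [if_neg h.1, if_neg h.2]; ring)
    have hB : (∀ i : ZMod L, ¬ i.val < NA → b i = γ i) ∨
        ∀ i : ZMod L, ¬ i.val < NA → b i = !γ i := by
      by_contra h
      rw [not_or] at h
      exact hb (by rw [hψ]; simp only [if_neg h.1, if_neg h.2]; ring)
    have glue : ∀ c : ZMod L → Bool, (∀ i : ZMod L, i.val < NA → b i = c i) →
        (∀ i : ZMod L, ¬ i.val < NA → b i = c i) → b = c := fun c h h' =>
      funext fun i => (em (i.val < NA)).elim (h i) (h' i)
    rcases hA with hA | hA <;> rcases hB with hB | hB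
    · exact Or.inl (glue _ hA hB)
    · exact Or.inr (Or.inr (Or.inl (glue _ (fun i hi => by rw [hA i hi, hlo i hi])
        fun i hi => by rw [hB i hi, hhi i hi])))
    · exact Or.inr (Or.inr (Or.inr (glue _ (fun i hi => by rw [hA i hi, hlo i hi])
        fun i hi => by rw [hB i hi, hhi i hi, Bool.not_not])))
    · exact Or.inr (Or.inl (glue _ hA hB))
  have key : s ^ 2 = e ∧ t ^ 2 = e → (czxMatrix L).mulVec ψ = (s * t * czxPhase γ) • ψ := by
    rintro ⟨hs2, ht2⟩
    have hee : e * e = 1 := by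
      rw [← hpq]; linear_combination czxPhase δ * czxPhase δ * hp + hq
    have hst : s ^ 2 * t ^ 2 = 1 := by rw [hs2, ht2, hee]
    have hpe : czxPhase γ * e = czxPhase δ := by
      rw [← hpq]; linear_combination czxPhase δ * hp
    funext b
    rw [czxMatrix_mulVec_apply hLe, Pi.smul_apply, smul_eq_mul]
    by_cases hb : b = γ ∨ b = (fun i => !γ i) ∨ b = δ ∨ b = fun i => !δ i
    · rcases hb with rfl | rfl | rfl | rfl
      · rw [hψγ, hψγ']; ring
      · simp only [Bool.not_not, czxPhase_compl hLe]
        rw [hψγ, hψγ']; linear_combination -(1 / 2) * czxPhase γ * hst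
      · rw [hψδ, hψδ', ← hpe, ← ht2]; ring
      · simp only [Bool.not_not, czxPhase_compl hLe]
        rw [hψδ, hψδ', ← hpe, ← hs2]; ring
    · have hb' : ψ b = 0 := not_not.1 fun h => hb (hψ₀ b h)
      have hb'' : ψ (fun i => !b i) = 0 := not_not.1 fun h => hb (by
        have hc : ∀ c : ZMod L → Bool, (fun i => !b i) = c → b = fun i => !c i := by
          rintro c rfl; simp
        rcases hψ₀ _ h with h | h | h | h
        · exact Or.inr (Or.inl (hc _ h))
        · exact Or.inl (by simpa using hc _ h)
        · exact Or.inr (Or.inr (Or.inr (hc _ h)))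
        · exact Or.inr (Or.inr (Or.inl (by simpa using hc _ h))))
      rw [hb', hb'', mul_zero, mul_zero]
  refine ⟨⟨?_, fun h => ⟨_, key h⟩⟩, key⟩
  rintro ⟨μ, hμ⟩
  have happ : ∀ b, czxPhase b * ψ (fun i => !b i) = μ * ψ b := fun b => by
    rw [← czxMatrix_mulVec_apply hLe, hμ, Pi.smul_apply, smul_eq_mul]
  have e₁ := happ γ
  have e₂ := happ δ
  have e₃ := happ fun i => !δ i
  simp only [Bool.not_not, czxPhase_compl hLe] at e₃
  rw [hψγ, hψγ'] at e₁
  rw [hψδ, hψδ'] at e₂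
  rw [hψδ, hψδ'] at e₃
  have hμ' : μ = czxPhase γ * s * t := by linear_combination -2 * e₁
  rw [hμ'] at e₂ e₃
  rw [← hpq]
  constructor
  · refine mul_left_cancel₀ ht ?_
    linear_combination -2 * czxPhase γ * e₃ - t * s ^ 2 * hp
  · refine mul_left_cancel₀ hs ?_
    linear_combination -2 * czxPhase γ * e₂ - s * t ^ 2 * hp
end

section
/- Let L ≥ 2 be even and let A, B be two disjoint nonempty contiguous arcs of ZMod L whose union is ZMod L. Then the chain Hilbert space admits an orthonormal basis consisting of eigenvectors of U_CZX, each of which is separable with respect to the partition {A, B} (i.e., each basis vector has the form ψ(b) = f(b|_A) g(b|_B)). -/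
open Matrix

/-- A contiguous arc `{j, j+1, …, j+m−1}` in `ZMod L`. -/
def IsArc {L : ℕ} (A : Set (ZMod L)) : Prop :=
  ∃ (j : ZMod L) (m : ℕ), A = {x | ∃ k, k < m ∧ x = j + (k : ZMod L)}

/-- A vector of the chain Hilbert space separable with respect to the bipartition
`{A, B}`: `ψ(b) = f(b|_A) g(b|_B)`. -/
def SepVec2 {L : ℕ} (A B : Set (ZMod L)) (ψ : (ZMod L → Bool) → ℂ) : Prop :=
  ∃ (f : (A → Bool) → ℂ) (g : (B → Bool) → ℂ),
    ∀ b, ψ b = f (fun x => b x.1) * g (fun x => b x.1)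

/-- The relative amplitude of `|n s⟩` in the eigenvector `pairVec n o c s`. -/
noncomputable def pairCoeff {S : Type*} (n : S → S) (o : S → Bool) (c : S → ℂ) (s : S) : ℂ :=
  open Classical in if c s = c (n s) then (if o s then 1 else -1) else Complex.I

/-- A normalized vector supported on `{s, n s}`, an eigenvector of the signed flip
`|s⟩ ↦ c s |n s⟩`; the orientation `o` distinguishes the two eigenvectors of each orbit. -/
noncomputable def pairVec {S : Type*} [DecidableEq S] (n : S → S) (o : S → Bool) (c : S → ℂ)
    (s x : S) : ℂ :=
  ((√2 : ℝ) : ℂ)⁻¹ * ((if x = s then 1 else 0) + if x = n s then pairCoeff n o c s else 0)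

section PairVec

variable {S : Type*} {n : S → S} {o : S → Bool}

theorem pairVec_eq_zero [DecidableEq S] {c : S → ℂ} {s x : S} (h₁ : x ≠ s) (h₂ : x ≠ n s) :
    pairVec n o c s x = 0 := by
  simp [pairVec, h₁, h₂]

theorem inv_sqrt_two_mul_self : ((√2 : ℝ) : ℂ)⁻¹ * ((√2 : ℝ) : ℂ)⁻¹ = 1 / 2 := by
  rw [← mul_inv, ← Complex.ofReal_mul, Real.mul_self_sqrt (by norm_num)]
  norm_num

theorem conj_pairCoeff_mul_self (c : S → ℂ) (s : S) :
    (starRingEnd ℂ) (pairCoeff n o c s) * pairCoeff n o c s = 1 := by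
  unfold pairCoeff
  split_ifs <;> simp

theorem pairCoeff_involution (hn : ∀ s, n (n s) = s) (ho : ∀ s, o (n s) = !o s)
    (c : S → ℂ) (s : S) :
    pairCoeff n o c (n s) = -(starRingEnd ℂ) (pairCoeff n o c s) := by
  unfold pairCoeff
  rw [hn, ho]
  by_cases h : c s = c (n s)
  · cases o s <;> simp [h]
  · simp [h, Ne.symm h]

theorem ne_of_orientation (ho : ∀ s, o (n s) = !o s) (s : S) : n s ≠ s := by
  intro h
  have := ho s
  rw [h] at this
  cases hs : o s <;> simp [hs] at this

variable [DecidableEq S]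

theorem sum_conj_pairVec_mul [Fintype S] (c c' : S → ℂ) (s s' : S) :
    ∑ x, (starRingEnd ℂ) (pairVec n o c s x) * pairVec n o c' s' x =
      ((√2 : ℝ) : ℂ)⁻¹ * ((starRingEnd ℂ) (pairVec n o c s s') +
        (starRingEnd ℂ) (pairVec n o c s (n s')) * pairCoeff n o c' s') := by
  have h : ∀ x, pairVec n o c' s' x = ((√2 : ℝ) : ℂ)⁻¹ *
      ((if x = s' then 1 else 0) + if x = n s' then pairCoeff n o c' s' else 0) := fun _ => rfl
  simp only [h, mul_add, Finset.sum_add_distrib, mul_ite, mul_one, mul_zero,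
    Finset.sum_ite_eq', Finset.mem_univ, if_true]
  ring

theorem pairVec_orthogonal [Fintype S] (hn : ∀ s, n (n s) = s) (c c' : S → ℂ) {s s' : S}
    (h₁ : s' ≠ s) (h₂ : s' ≠ n s) :
    ∑ x, (starRingEnd ℂ) (pairVec n o c s x) * pairVec n o c' s' x = 0 := by
  have h₃ : n s' ≠ s := fun h => h₂ (by rw [← h, hn])
  have h₄ : n s' ≠ n s := fun h => h₁ (by rw [← hn s', h, hn])
  rw [sum_conj_pairVec_mul, pairVec_eq_zero h₁ h₂, pairVec_eq_zero h₃ h₄]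
  simp

theorem pairVec_orthonormal [Fintype S] (hn : ∀ s, n (n s) = s) (ho : ∀ s, o (n s) = !o s)
    (c : S → ℂ) (s s' : S) :
    ∑ x, (starRingEnd ℂ) (pairVec n o c s x) * pairVec n o c s' x =
      if s = s' then 1 else 0 := by
  have hne := ne_of_orientation ho s
  by_cases h₁ : s' = s
  · subst h₁
    have h := conj_pairCoeff_mul_self (n := n) (o := o) c s'
    have h2 := inv_sqrt_two_mul_self
    rw [sum_conj_pairVec_mul]
    simp only [pairVec, hne, hne.symm, if_true, if_false, map_mul, map_add, map_inv₀,
      Complex.conj_ofReal, map_one, map_zero]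
    linear_combination (1 + (starRingEnd ℂ) (pairCoeff n o c s') * pairCoeff n o c s') * h2 +
      (1 / 2) * h
  by_cases h₂ : s' = n s
  · subst h₂
    rw [sum_conj_pairVec_mul, pairCoeff_involution hn ho, hn]
    simp only [pairVec, hne, hne.symm, if_true, if_false, map_mul, map_add, map_inv₀,
      Complex.conj_ofReal, map_one, map_zero]
    ring
  · rw [pairVec_orthogonal hn c c h₁ h₂, if_neg (Ne.symm h₁)]

/-- `pairVec n o c s` is an eigenvector of `ψ ↦ (x ↦ c (n x) * ψ (n x))`. -/
theorem pairVec_eigen (hn : ∀ s, n (n s) = s) (ho : ∀ s, o (n s) = !o s)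
    {c : S → ℂ} (hc : ∀ s, c s = 1 ∨ c s = -1) (s x : S) :
    c (n x) * pairVec n o c s (n x) =
      (c (n s) * pairCoeff n o c s) * pairVec n o c s x := by
  have hne := ne_of_orientation ho s
  have key : c s = c (n s) * pairCoeff n o c s * pairCoeff n o c s := by
    unfold pairCoeff
    rcases hc s with h | h <;> rcases hc (n s) with h' | h' <;> cases o s <;>
      simp [h, h'] <;> norm_num
  by_cases h₁ : x = s
  · subst h₁
    simp only [pairVec, hne, hne.symm, if_true, if_false]
    ring
  by_cases h₂ : x = n s
  · subst h₂
    simp only [pairVec, hn, hne, hne.symm, if_true, if_false]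
    linear_combination ((√2 : ℝ) : ℂ)⁻¹ * key
  · have h₃ : n x ≠ s := fun h => h₂ (by rw [← h, hn])
    have h₄ : n x ≠ n s := fun h => h₁ (by rw [← hn x, h, hn])
    rw [pairVec_eq_zero h₁ h₂, pairVec_eq_zero h₃ h₄]
    simp

end PairVec

section Product

variable {S T : Type*} [DecidableEq S] [DecidableEq T]
  {n : S → S} {o : S → Bool} {n' : T → T} {o' : T → Bool} {F G : S → T → ℂ}

theorem sum_conj_pairVec_prod [Fintype S] [Fintype T]
    (hn : ∀ s, n (n s) = s) (ho : ∀ s, o (n s) = !o s)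
    (hn' : ∀ t, n' (n' t) = t) (ho' : ∀ t, o' (n' t) = !o' t)
    (hF : ∀ s t, F s (n' t) = F s t) (hG : ∀ s t, G (n s) t = G s t) (v w : S × T) :
    ∑ x : S × T, (starRingEnd ℂ) (pairVec n o (F · v.2) v.1 x.1 * pairVec n' o' (G v.1) v.2 x.2) *
      (pairVec n o (F · w.2) w.1 x.1 * pairVec n' o' (G w.1) w.2 x.2) =
      if v = w then 1 else 0 := by
  obtain ⟨s, t⟩ := v
  obtain ⟨s', t'⟩ := w
  have split : ∑ x : S × T, (starRingEnd ℂ) (pairVec n o (F · t) s x.1 * pairVec n' o' (G s) t x.2) *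
      (pairVec n o (F · t') s' x.1 * pairVec n' o' (G s') t' x.2) =
      (∑ x, (starRingEnd ℂ) (pairVec n o (F · t) s x) * pairVec n o (F · t') s' x) *
      ∑ y, (starRingEnd ℂ) (pairVec n' o' (G s) t y) * pairVec n' o' (G s') t' y := by
    rw [Finset.sum_mul_sum, Fintype.sum_prod_type]
    refine Finset.sum_congr rfl fun x _ => Finset.sum_congr rfl fun y _ => ?_
    rw [map_mul]
    ring
  simp only [split, Prod.mk.injEq]
  by_cases hs : s' = s ∨ s' = n s
  · by_cases ht : t' = t ∨ t' = n' t
    · have e₁ : (F · t') = (F · t) := by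
        funext x
        rcases ht with rfl | rfl <;> simp [hF]
      have e₂ : G s' = G s := by
        funext y
        rcases hs with rfl | rfl <;> simp [hG]
      rw [e₁, e₂, pairVec_orthonormal hn ho, pairVec_orthonormal hn' ho', ite_and]
      split_ifs <;> simp
    · rw [not_or] at ht
      rw [pairVec_orthogonal hn' _ _ ht.1 ht.2, mul_zero, if_neg fun h => ht.1 h.2.symm]
  · rw [not_or] at hs
    rw [pairVec_orthogonal hn _ _ hs.1 hs.2, zero_mul, if_neg fun h => hs.1 h.1.symm]

theorem pairVec_prod_eigen
    (hn : ∀ s, n (n s) = s) (ho : ∀ s, o (n s) = !o s)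
    (hn' : ∀ t, n' (n' t) = t) (ho' : ∀ t, o' (n' t) = !o' t)
    (hF : ∀ s t, F s (n' t) = F s t) (hG : ∀ s t, G (n s) t = G s t)
    (hF1 : ∀ s t, F s t = 1 ∨ F s t = -1) (hG1 : ∀ s t, G s t = 1 ∨ G s t = -1)
    (v x : S × T) :
    F (n x.1) (n' x.2) * G (n x.1) (n' x.2) *
      (pairVec n o (F · v.2) v.1 (n x.1) * pairVec n' o' (G v.1) v.2 (n' x.2)) =
    (F (n v.1) v.2 * pairCoeff n o (F · v.2) v.1 *
      (G v.1 (n' v.2) * pairCoeff n' o' (G v.1) v.2)) *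
      (pairVec n o (F · v.2) v.1 x.1 * pairVec n' o' (G v.1) v.2 x.2) := by
  obtain ⟨s, t⟩ := v
  obtain ⟨x, y⟩ := x
  simp only [hF, hG]
  have e₁ := pairVec_eigen hn ho (c := (F · t)) (fun s => hF1 s t) s x
  have e₂ := pairVec_eigen hn' ho' (c := G s) (hG1 s) t y
  by_cases hs : x = s ∨ x = n s
  · by_cases ht : y = t ∨ y = n' t
    · have h₁ : F (n x) y = F (n x) t := by
        rcases ht with rfl | rfl <;> simp [hF]
      have h₂ : G x (n' y) = G s (n' y) := by
        rcases hs with rfl | rfl <;> simp [hG]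
      rw [h₁, h₂]
      calc _ = (F (n x) t * pairVec n o (F · t) s (n x)) *
            (G s (n' y) * pairVec n' o' (G s) t (n' y)) := by ring
        _ = _ := by rw [e₁, e₂]; ring
    · rw [not_or] at ht
      have h₃ : n' y ≠ t := fun h => ht.2 (by rw [← h, hn'])
      have h₄ : n' y ≠ n' t := fun h => ht.1 (by rw [← hn' y, h, hn'])
      rw [pairVec_eq_zero ht.1 ht.2, pairVec_eq_zero h₃ h₄]
      simp
  · rw [not_or] at hs
    have h₃ : n x ≠ s := fun h => hs.2 (by rw [← h, hn])
    have h₄ : n x ≠ n s := fun h => hs.1 (by rw [← hn x, h, hn])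
    rw [pairVec_eq_zero hs.1 hs.2, pairVec_eq_zero h₃ h₄]
    simp

end Product

/-- The diagonal entry of the controlled-`Z` gate. -/
def czSign (u v : Bool) : ℂ := if u && v then -1 else 1

theorem czSign_eq_or (u v : Bool) : czSign u v = 1 ∨ czSign u v = -1 := by
  cases u <;> cases v <;> simp [czSign]

theorem czSign_cross (al ar bl br : Bool) :
    czSign ar bl * czSign br al = czSign (xor bl br) al * czSign (xor al ar) bl := by
  cases al <;> cases ar <;> cases bl <;> cases br <;> simp [czSign]

theorem czxMatrix_mulVec (L : ℕ) [NeZero L] (ψ : (ZMod L → Bool) → ℂ) (b : ZMod L → Bool) :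
    (czxMatrix L).mulVec ψ b =
      (∏ i, czSign (!b i) (!b (i + 1))) * ψ (fun i => !b i) := by
  rw [Matrix.mulVec, dotProduct, Finset.sum_eq_single (fun i => !b i)]
  · simp [czxMatrix, czSign]
  · intro b' _ hb
    have : b ≠ fun i => !b' i := by
      rintro rfl
      simp at hb
    simp [czxMatrix, this]
  · simp

/-- A nonempty proper subset of the ring has a point whose successor leaves it. -/
theorem exists_mem_succ_notMem {L : ℕ} [NeZero L] {A : Set (ZMod L)}
    (hA : A.Nonempty) (hA' : Aᶜ.Nonempty) : ∃ x ∈ A, x + 1 ∉ A := by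
  by_contra! h
  obtain ⟨a, ha⟩ := hA
  obtain ⟨b, hb⟩ := hA'
  have key : ∀ k : ℕ, a + k ∈ A := by
    intro k
    induction k with
    | zero => simpa using ha
    | succ k ih => simpa [add_assoc] using h _ ih
  apply hb
  simpa using key (b - a).val

theorem IsArc.exit_unique {L : ℕ} {A : Set (ZMod L)} (hA : IsArc A) {x y : ZMod L}
    (hx : x ∈ A) (hx' : x + 1 ∉ A) (hy : y ∈ A) (hy' : y + 1 ∉ A) : x = y := by
  obtain ⟨j, m, rfl⟩ := hA
  have key : ∀ k : ℕ, k < m → j + (k : ZMod L) + 1 ∉ {x | ∃ k, k < m ∧ x = j + (k : ZMod L)} →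
      m = k + 1 := by
    intro k hk h
    by_contra hne
    exact h ⟨k + 1, by omega, by push_cast; ring⟩
  obtain ⟨k, hk, rfl⟩ := hx
  obtain ⟨l, hl, rfl⟩ := hy
  have h₁ := key k hk hx'
  have h₂ := key l hl hy'
  rw [show k = l by omega]

theorem IsArc.entry_unique {L : ℕ} {A : Set (ZMod L)} (hA : IsArc A) {x y : ZMod L}
    (hx : x ∉ A) (hx' : x + 1 ∈ A) (hy : y ∉ A) (hy' : y + 1 ∈ A) : x = y := by
  obtain ⟨j, m, rfl⟩ := hA
  have key : ∀ z : ZMod L, z ∉ {x | ∃ k, k < m ∧ x = j + (k : ZMod L)} →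
      z + 1 ∈ {x | ∃ k, k < m ∧ x = j + (k : ZMod L)} → z + 1 = j := by
    rintro z hz ⟨k, hk, h⟩
    cases k with
    | zero => simpa using h
    | succ k =>
      refine absurd ⟨k, by omega, ?_⟩ hz
      push_cast at h
      linear_combination h
  exact add_right_cancel ((key x hx hx').trans (key y hy hy').symm)

/-- The product of the controlled-`Z` signs over the links inside `A`. -/
noncomputable def innerSign {L : ℕ} [NeZero L] (A : Set (ZMod L)) (s : A → Bool) : ℂ :=
  open Classical in
  ∏ i : ZMod L, if h : i ∈ A ∧ i + 1 ∈ A then czSign (s ⟨i, h.1⟩) (s ⟨i + 1, h.2⟩) else 1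

theorem innerSign_eq_or {L : ℕ} [NeZero L] (A : Set (ZMod L)) (s : A → Bool) :
    innerSign A s = 1 ∨ innerSign A s = -1 := by
  classical
  unfold innerSign
  refine Finset.prod_induction _ (fun z : ℂ => z = 1 ∨ z = -1) ?_ (Or.inl rfl) ?_
  · rintro _ _ (rfl | rfl) (rfl | rfl) <;> simp
  · intro i _
    split_ifs
    · exact czSign_eq_or _ _
    · exact Or.inl rfl

theorem prod_czSign_eq {L : ℕ} [NeZero L] {A : Set (ZMod L)} (hA : IsArc A) {x y : ZMod L}
    (hx : x ∈ A) (hx' : x + 1 ∉ A) (hy : y ∉ A) (hy' : y + 1 ∈ A) (b : ZMod L → Bool) :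
    ∏ i, czSign (b i) (b (i + 1)) =
      innerSign A (fun i => b i) * innerSign Aᶜ (fun i => b i) *
        (czSign (b x) (b (x + 1)) * czSign (b y) (b (y + 1))) := by
  classical
  have hcross : czSign (b x) (b (x + 1)) * czSign (b y) (b (y + 1)) =
      ∏ i, (if i = x then czSign (b i) (b (i + 1)) else 1) *
        (if i = y then czSign (b i) (b (i + 1)) else 1) := by
    rw [Finset.prod_mul_distrib]
    simp
  rw [hcross, innerSign, innerSign, ← Finset.prod_mul_distrib, ← Finset.prod_mul_distrib]
  refine Finset.prod_congr rfl fun i _ => ?_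
  by_cases h₁ : i ∈ A <;> by_cases h₂ : i + 1 ∈ A
  · have : i ≠ x := by rintro rfl; exact hx' h₂
    have : i ≠ y := by rintro rfl; exact hy h₁
    simp [*]
  · obtain rfl := hA.exit_unique h₁ h₂ hx hx'
    have : i ≠ y := by rintro rfl; exact hy h₁
    simp [*]
  · obtain rfl := hA.entry_unique h₁ h₂ hy hy'
    have : i ≠ x := by rintro rfl; exact h₁ hx
    simp [*]
  · have : i ≠ x := by rintro rfl; exact h₁ hx
    have : i ≠ y := by rintro rfl; exact h₂ hy'
    simp [*]

/-- For any bipartition of the ring into two contiguous arcs, the chain Hilbert space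
admits an orthonormal basis of `U_CZX`-eigenvectors each of which is bipartite separable
with respect to `{A, B}`. -/
theorem czx_has_bipartite_separable_eigenbasis
    (L : ℕ) [NeZero L] (hL : 2 ≤ L) (hLe : Even L)
    (A B : Set (ZMod L)) (hA : IsArc A) (hB : IsArc B)
    (hAne : A.Nonempty) (hBne : B.Nonempty)
    (hAB : Disjoint A B) (hUnion : A ∪ B = Set.univ) :
    ∃ e : (ZMod L → Bool) → ((ZMod L → Bool) → ℂ),
      (∀ v w, ∑ x, (starRingEnd ℂ) (e v x) * e w x = if v = w then 1 else 0) ∧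
      (∀ v, ∃ μ : ℂ, (czxMatrix L).mulVec (e v) = μ • e v) ∧
      (∀ v, SepVec2 A B (e v)) := by
  classical
  obtain rfl : B = Aᶜ := (isCompl_iff.mpr ⟨hAB, codisjoint_iff.mpr hUnion⟩).compl_eq.symm
  obtain ⟨x, hx, hx'⟩ := exists_mem_succ_notMem hAne hBne
  obtain ⟨y, hy, hy'⟩ := exists_mem_succ_notMem hBne (by rwa [compl_compl])
  rw [Set.notMem_compl_iff] at hy'
  let al : A := ⟨y + 1, hy'⟩
  let ar : A := ⟨x, hx⟩
  let bl : (Aᶜ : Set (ZMod L)) := ⟨x + 1, hx'⟩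
  let br : (Aᶜ : Set (ZMod L)) := ⟨y, hy⟩
  let n : (A → Bool) → A → Bool := fun s i => !s i
  let n' : ((Aᶜ : Set (ZMod L)) → Bool) → (Aᶜ : Set (ZMod L)) → Bool := fun t i => !t i
  let o : (A → Bool) → Bool := fun s => s al
  let o' : ((Aᶜ : Set (ZMod L)) → Bool) → Bool := fun t => t bl
  let F : (A → Bool) → ((Aᶜ : Set (ZMod L)) → Bool) → ℂ :=
    fun s t => innerSign A s * czSign (xor (t bl) (t br)) (s al)
  let G : (A → Bool) → ((Aᶜ : Set (ZMod L)) → Bool) → ℂ :=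
    fun s t => innerSign Aᶜ t * czSign (xor (s al) (s ar)) (t bl)
  have hn : ∀ s, n (n s) = s := fun s => by simp [n]
  have hn' : ∀ t, n' (n' t) = t := fun t => by simp [n']
  have ho : ∀ s, o (n s) = !o s := fun s => rfl
  have ho' : ∀ t, o' (n' t) = !o' t := fun t => rfl
  have hF : ∀ s t, F s (n' t) = F s t := fun s t => by simp [F, n']
  have hG : ∀ s t, G (n s) t = G s t := fun s t => by simp [G, n]
  have sign_mul : ∀ z w : ℂ, (z = 1 ∨ z = -1) → (w = 1 ∨ w = -1) → (z * w = 1 ∨ z * w = -1) := by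
    rintro _ _ (rfl | rfl) (rfl | rfl) <;> simp
  have hF1 : ∀ s t, F s t = 1 ∨ F s t = -1 := fun s t =>
    sign_mul _ _ (innerSign_eq_or A s) (czSign_eq_or _ _)
  have hG1 : ∀ s t, G s t = 1 ∨ G s t = -1 := fun s t =>
    sign_mul _ _ (innerSign_eq_or Aᶜ t) (czSign_eq_or _ _)
  let E : (ZMod L → Bool) ≃ (A → Bool) × ((Aᶜ : Set (ZMod L)) → Bool) :=
    Equiv.piEquivPiSubtypeProd (· ∈ A) fun _ => Bool
  have hphase : ∀ b : ZMod L → Bool, ∏ i, czSign (!b i) (!b (i + 1)) =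
      F (n (E b).1) (n' (E b).2) * G (n (E b).1) (n' (E b).2) := by
    intro b
    have h := prod_czSign_eq hA hx hx' hy hy' (fun i => !b i)
    rw [czSign_cross] at h
    refine h.trans ?_
    change _ = innerSign A (fun i => !b i) *
      czSign (xor (!b (x + 1)) (!b y)) (!b (y + 1)) *
      (innerSign Aᶜ (fun i => !b i) * czSign (xor (!b (y + 1)) (!b x)) (!b (x + 1)))
    ring
  refine ⟨fun v b => pairVec n o (F · (E v).2) (E v).1 (E b).1 *
    pairVec n' o' (G (E v).1) (E v).2 (E b).2, ?_, ?_, ?_⟩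
  · intro v w
    have h := sum_conj_pairVec_prod hn ho hn' ho' hF hG (E v) (E w)
    rw [← E.sum_comp] at h
    simpa only [E.apply_eq_iff_eq] using h
  · intro v
    refine ⟨F (n (E v).1) (E v).2 * pairCoeff n o (F · (E v).2) (E v).1 *
      (G (E v).1 (n' (E v).2) * pairCoeff n' o' (G (E v).1) (E v).2), funext fun b => ?_⟩
    rw [czxMatrix_mulVec, hphase]
    exact pairVec_prod_eigen hn ho hn' ho' hF hG hF1 hG1 (E v) (E b)
  · intro v
    exact ⟨_, _, fun b => rfl⟩
end

section
/- Let L ≥ 2 be even, σ ∈ {+1, −1}, and x ∈ ZMod L any site. The partial trace over the qubit at site x of ρ_{∞,σ} := 2^{−L}(1 + σ·U_CZX) equals 2^{−(L−1)} times the identity operator on the remaining L−1 qubits. Here the partial trace over site x of an operator M, written as a matrix M(b, b′) indexed by bit strings on ZMod L, is the matrix on bit strings over the sites ZMod L ∖ {x} with entries (Tr_x M)(c, c′) = Σ_{v∈{0,1}} M(c[x↦v], c′[x↦v]), where c[x↦v] denotes the bit string extending c by the value v at site x. -/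
open Matrix

/-- The CZX operator flips every bit, so its matrix element between two bit strings that agree at
some site vanishes. -/
theorem czxMatrix_apply_eq_zero {L : ℕ} [NeZero L] {b b' : ZMod L → Bool} {x : ZMod L}
    (h : b x = b' x) : czxMatrix L b b' = 0 := by
  refine if_neg fun hb => ?_
  have hx := congrFun hb x
  simp [h] at hx

/-- Two extensions of bit strings by the same value at the site `x` agree iff the bit strings
agree. -/
theorem extend_eq_extend_iff {ι : Type*} [DecidableEq ι] {x : ι} (v : Bool)
    (c c' : {y : ι // y ≠ x} → Bool) :
    ((fun y => if h : y = x then v else c ⟨y, h⟩) =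
      fun y => if h : y = x then v else c' ⟨y, h⟩) ↔ c = c' := by
  refine ⟨fun h => funext fun y => ?_, fun h => by rw [h]⟩
  simpa [y.2] using congrFun h y

/-- Tracing out any single qubit of the infinite-temperature CZX state
`ρ_{∞,σ} = 2^{−L}(1 + σ U_CZX)` yields the maximally mixed state on the remaining
`L − 1` qubits. -/
theorem czx_infinite_temperature_state_maximally_disordered_subsystems
    (L : ℕ) [NeZero L] (hL : 2 ≤ L) (hLe : Even L)
    (σ : ℂ) (hσ : σ = 1 ∨ σ = -1) (x : ZMod L)
    (ρ : Matrix (ZMod L → Bool) (ZMod L → Bool) ℂ)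
    (hρ : ρ = ((2 : ℂ) ^ L)⁻¹ • (1 + σ • czxMatrix L)) :
    (Matrix.of fun c c' : {y : ZMod L // y ≠ x} → Bool =>
        ∑ v : Bool, ρ (fun y => if h : y = x then v else c ⟨y, h⟩)
          (fun y => if h : y = x then v else c' ⟨y, h⟩))
      = ((2 : ℂ) ^ (L - 1))⁻¹ •
          (1 : Matrix ({y : ZMod L // y ≠ x} → Bool) ({y : ZMod L // y ≠ x} → Bool) ℂ) := by
  subst hρ
  obtain ⟨n, rfl⟩ : ∃ n, L = n + 1 := ⟨L - 1, by omega⟩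
  ext c c'
  simp only [of_apply, Matrix.smul_apply, Matrix.add_apply, Matrix.one_apply,
    extend_eq_extend_iff, smul_eq_mul]
  rw [Fintype.sum_bool, czxMatrix_apply_eq_zero (x := x) (by simp),
    czxMatrix_apply_eq_zero (x := x) (by simp), Nat.add_sub_cancel, pow_succ]
  field_simp
  ring
end

section
/- Let H_L and H_R be finite-dimensional complex inner product spaces, ρ a positive semidefinite operator on H_L ⊗ H_R, and let A₊, A₋ be operators on H_L and B₊, B₋ operators on H_R; write Â := A ⊗ 1 and B̂ := 1 ⊗ B for their extensions to H_L ⊗ H_R. Suppose (Â₊ B̂₋ + Â₋ B̂₊) ρ = 0 and Â₋ B̂₊ ρ ≠ 0. Then Tr[(A₋† A₊ ⊗ B₊† B₋) ρ] = − Tr[(A₋† A₋ ⊗ B₊† B₊) ρ], and this common quantity Tr[(A₋† A₋ ⊗ B₊† B₊) ρ] is a strictly positive real number; in particular Tr[(A₋† A₊ ⊗ B₊† B₋) ρ] is a strictly negative real number. -/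
open Matrix Kronecker ComplexOrder

open scoped MatrixOrder in
/-- A positive semidefinite `ρ` assigns a strictly positive expectation value to `Mᴴ * M` unless
`M` annihilates `ρ`. -/
theorem Matrix.PosSemidef.trace_conjTranspose_mul_self_mul_pos {m n : Type*} [Fintype m] [Fintype n]
    {ρ : Matrix n n ℂ} (hρ : ρ.PosSemidef) {M : Matrix m n ℂ} (hM : M * ρ ≠ 0) :
    0 < (Mᴴ * M * ρ).trace := by
  classical
  obtain ⟨C, rfl⟩ := CStarAlgebra.nonneg_iff_eq_star_mul_self.mp hρ.nonneg
  rw [star_eq_conjTranspose] at hM ⊢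
  have hMC : M * Cᴴ ≠ 0 := fun h => hM (by rw [← Matrix.mul_assoc, h, Matrix.zero_mul])
  have htr : (Mᴴ * M * (Cᴴ * C)).trace = ((M * Cᴴ)ᴴ * (M * Cᴴ)).trace := by
    rw [conjTranspose_mul, conjTranspose_conjTranspose, ← Matrix.mul_assoc, trace_mul_comm]
    simp only [Matrix.mul_assoc]
  rw [htr]
  exact (posSemidef_conjTranspose_mul_self _).trace_nonneg.lt_of_ne'
    (mt trace_conjTranspose_mul_self_eq_zero_iff.mp hMC)

/-- If `(Â₊B̂₋ + Â₋B̂₊)ρ = 0` while `Â₋B̂₊ρ ≠ 0` for a positive semidefinite `ρ`, then the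
two-point function `Tr[(A₋†A₊ ⊗ B₊†B₋)ρ]` equals `−Tr[(A₋†A₋ ⊗ B₊†B₊)ρ]`, which is a
strictly negative real number. -/
theorem charged_cross_terms_force_order_parameter
    {ι κ : Type*} [Fintype ι] [DecidableEq ι] [Fintype κ] [DecidableEq κ]
    (ρ : Matrix (ι × κ) (ι × κ) ℂ) (hρ : ρ.PosSemidef)
    (Ap Am : Matrix ι ι ℂ) (Bp Bm : Matrix κ κ ℂ)
    (h0 : (Ap ⊗ₖ Bm + Am ⊗ₖ Bp) * ρ = 0)
    (hne : (Am ⊗ₖ Bp) * ρ ≠ 0) :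
    ∃ c : ℝ, 0 < c ∧
      (((Amᴴ * Am) ⊗ₖ (Bpᴴ * Bp)) * ρ).trace = (c : ℂ) ∧
      (((Amᴴ * Ap) ⊗ₖ (Bpᴴ * Bm)) * ρ).trace = (-c : ℂ) := by
  have hpos := hρ.trace_conjTranspose_mul_self_mul_pos hne
  rw [conjTranspose_kronecker, ← mul_kronecker_mul] at hpos
  obtain ⟨hre, him⟩ := Complex.pos_iff.mp hpos
  have hc : (((Amᴴ * Am) ⊗ₖ (Bpᴴ * Bp)) * ρ).trace =
      ((((Amᴴ * Am) ⊗ₖ (Bpᴴ * Bp)) * ρ).trace.re : ℂ) :=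
    Complex.ext rfl (by simpa using him.symm)
  refine ⟨_, hre, hc, ?_⟩
  rw [← hc]
  have hcross : (Ap ⊗ₖ Bm) * ρ = -((Am ⊗ₖ Bp) * ρ) := by
    rwa [Matrix.add_mul, add_eq_zero_iff_eq_neg] at h0
  rw [mul_kronecker_mul, mul_kronecker_mul, Matrix.mul_assoc, Matrix.mul_assoc, hcross,
    Matrix.mul_neg, trace_neg]
end

section
/- Let n ≥ 1 and let κ₁, …, κ_n be finite nonempty types, and let ψ : (∏_{i=1}^n κ_i) → ℂ be a function (a vector of the n-partite Hilbert space whose computational basis is indexed by ∏_i κ_i). Suppose that for every index i there exist functions g_i : κ_i → ℂ and h_i : (∏_{j≠i} κ_j) → ℂ such that ψ(x) = g_i(x_i) · h_i(x restricted to the coordinates j ≠ i) for all x. Then ψ is fully separable: there exist functions f_i : κ_i → ℂ with ψ(x) = ∏_{i=1}^n f_i(x_i) for all x. -/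
section ProductState

variable {ι R : Type*} [DecidableEq ι] {κ : ι → Type*}

/-- If `ψ` factorizes as a function of the coordinate `i` times a function of the others, then the
`i`-th coordinates of two arguments can be swapped without changing the product of the values. -/
theorem update_mul_eq_of_single_site_separable [CommMonoid R] {ψ : (∀ i, κ i) → R} {i : ι}
    (h : ∃ (g : κ i → R) (h' : (∀ j : {j : ι // j ≠ i}, κ j.1) → R),
      ∀ x, ψ x = g (x i) * h' (fun j => x j.1))
    (y z : ∀ i, κ i) (u : κ i) :
    ψ (Function.update y i u) * ψ z =
      ψ (Function.update y i (z i)) * ψ (Function.update z i u) := by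
  obtain ⟨g, h', hψ⟩ := h
  have hrest (w : ∀ i, κ i) (v : κ i) :
      (fun j : {j : ι // j ≠ i} => Function.update w i v j.1) =
        fun j : {j : ι // j ≠ i} => w j.1 :=
    funext fun j => Function.update_of_ne j.2 v w
  simp only [hψ, hrest, Function.update_self]
  rw [mul_mul_mul_comm, mul_comm (g u) (g (z i)), mul_mul_mul_comm]

/-- Changing the coordinates in `s` of a point where `ψ` does not vanish multiplies `ψ` by the
product of the ratios for the single-coordinate changes. -/
theorem piecewise_eq_mul_prod_of_single_site_separable [Field R] {ψ : (∀ i, κ i) → R}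
    (h : ∀ i, ∃ (g : κ i → R) (h' : (∀ j : {j : ι // j ≠ i}, κ j.1) → R),
      ∀ x, ψ x = g (x i) * h' (fun j => x j.1))
    {a : ∀ i, κ i} (ha : ψ a ≠ 0) (x : ∀ i, κ i) (s : Finset ι) :
    ψ (s.piecewise x a) = ψ a * ∏ i ∈ s, ψ (Function.update a i (x i)) / ψ a := by
  induction s using Finset.induction_on with
  | empty => simp
  | insert j s hj ih =>
    have hswap := update_mul_eq_of_single_site_separable (h j) (s.piecewise x a) a (x j)
    rw [← Finset.piecewise_eq_of_notMem s x a hj, Function.update_eq_self] at hswap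
    rw [Finset.piecewise_insert, Finset.prod_insert hj, mul_left_comm, ← ih, div_mul_eq_mul_div,
      eq_div_iff ha, hswap, mul_comm]

end ProductState

/-- A pure `n`-partite state (a complex function on `∏ i, κ i`) that is bipartite
separable under every single-site-versus-rest bipartition is fully separable. -/
theorem fully_separable_of_all_single_site_bipartite_separable
    (n : ℕ) (hn : 1 ≤ n) (κ : Fin n → Type*)
    [∀ i, Fintype (κ i)] [∀ i, Nonempty (κ i)]
    (ψ : (∀ i, κ i) → ℂ)
    (h : ∀ i : Fin n, ∃ (g : κ i → ℂ) (h' : (∀ j : {j : Fin n // j ≠ i}, κ j.1) → ℂ),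
      ∀ x, ψ x = g (x i) * h' (fun j => x j.1)) :
    ∃ f : ∀ i, κ i → ℂ, ∀ x, ψ x = ∏ i, f i (x i) := by
  by_cases hψ : ∀ x, ψ x = 0
  · refine ⟨fun _ _ => 0, fun x => ?_⟩
    rw [hψ x, Finset.prod_eq_zero (Finset.mem_univ ⟨0, hn⟩) rfl]
  · push Not at hψ
    obtain ⟨a, ha⟩ := hψ
    refine ⟨fun i t => (if i = ⟨0, hn⟩ then ψ a else 1) * (ψ (Function.update a i t) / ψ a),
      fun x => ?_⟩
    rw [Finset.prod_mul_distrib, Fintype.prod_ite_eq',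
      ← piecewise_eq_mul_prod_of_single_site_separable h ha x Finset.univ, Finset.piecewise_univ]
end

section
/- Let L ≥ 2 be even and consider the periodic chain of L qubits. Define Z_x by Z_x|b⟩ = (−1)^{b_x}|b⟩, the total charge Q = Σ_{x∈ZMod L} Z_x, and the translation T by (Tψ)(b) = ψ(i ↦ b_{i+1}). Let P be the orthogonal projection onto the kernel of Q (the span of the computational basis vectors |b⟩ whose bit strings have exactly L/2 ones), and set ρ₀ := P / Tr(P). Then ρ₀ is a density operator (positive semidefinite with trace 1) satisfying Q ρ₀ = 0 and T ρ₀ T† = ρ₀, and ρ₀ is fully separable: ρ₀ = Σ_i p_i |ψ_i⟩⟨ψ_i| with finitely many terms, p_i > 0, and each ψ_i a product over sites, i.e., ψ_i(b) = ∏_{x∈ZMod L} f_{i,x}(b_x) for some functions f_{i,x} : {0,1} → ℂ. -/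
open Matrix ComplexOrder

/-- The total charge `Q = Σ_x Z_x`, where `Z_x|b⟩ = (−1)^{b_x}|b⟩`. -/
noncomputable def chargeQ (L : ℕ) [NeZero L] :
    Matrix (ZMod L → Bool) (ZMod L → Bool) ℂ :=
  Matrix.diagonal fun b => ∑ x : ZMod L, (if b x then (-1 : ℂ) else 1)

/-- The translation `T`: `(Tψ)(b) = ψ(i ↦ b_{i+1})`. -/
noncomputable def transT (L : ℕ) [NeZero L] :
    Matrix (ZMod L → Bool) (ZMod L → Bool) ℂ :=
  Matrix.of fun b b' => if b' = (fun i => b (i + 1)) then 1 else 0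

/-- Some bit string of even length `L` has exactly `L / 2` ones. -/
lemma exists_half_filled (L : ℕ) [NeZero L] (hLe : Even L) :
    ∃ b : ZMod L → Bool, 2 * (Finset.univ.filter fun x => b x).card = L := by
  obtain ⟨k, hk⟩ := hLe
  obtain ⟨s, -, hs⟩ := Finset.exists_subset_card_eq
    (s := (Finset.univ : Finset (ZMod L))) (n := k) (by
      rw [Finset.card_univ, ZMod.card]
      omega)
  refine ⟨fun x => decide (x ∈ s), ?_⟩
  simp only [decide_eq_true_eq, Finset.filter_univ_mem, hs]
  omega

/-- The eigenvalue of `Q` on a half-filled bit string vanishes. -/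
lemma sum_sign_eq_zero {L : ℕ} [NeZero L] {b : ZMod L → Bool}
    (hb : 2 * (Finset.univ.filter fun x => b x).card = L) :
    ∑ x : ZMod L, (if b x then (-1 : ℂ) else 1) = 0 := by
  have hsign : ∀ x, (if b x then (-1 : ℂ) else 1) = 1 - 2 * (if b x then 1 else 0) := by
    intro x
    split_ifs <;> norm_num
  have hcast : (2 : ℂ) * (Finset.univ.filter fun x => b x).card = L := by
    exact_mod_cast hb
  simp only [hsign, Finset.sum_sub_distrib, ← Finset.mul_sum, Finset.sum_boole]
  simp [hcast, ZMod.card]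

/-- Translating a bit string preserves its number of ones. -/
lemma card_filter_shift {L : ℕ} [NeZero L] (b : ZMod L → Bool) :
    (Finset.univ.filter fun x => b (x + 1)).card = (Finset.univ.filter fun x => b x).card := by
  simp only [Finset.card_filter]
  exact Equiv.sum_comp (Equiv.addRight (1 : ZMod L)) fun x => if b x then 1 else 0

/-- Conjugation by `T` translates the entries of a diagonal matrix. -/
lemma transT_mul_diagonal_mul_conjTranspose (L : ℕ) [NeZero L] (d : (ZMod L → Bool) → ℂ) :
    transT L * diagonal d * (transT L)ᴴ = diagonal fun b => d fun i => b (i + 1) := by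
  have hinj : ∀ b b' : ZMod L → Bool,
      ((fun i => b (i + 1)) = fun i => b' (i + 1)) ↔ b = b' := fun b b' =>
    (Equiv.addRight (1 : ZMod L)).surjective.injective_comp_right.eq_iff
  ext b b'
  rcases eq_or_ne b b' with rfl | h
  · simp [Matrix.mul_apply, transT, Matrix.diagonal_apply, apply_ite]
  · simp [Matrix.mul_apply, transT, Matrix.diagonal_apply, apply_ite, hinj, h, h.symm]

/-- The computational basis vectors are product states. -/
lemma prod_ite_eq_single {L : ℕ} [NeZero L] (a : ZMod L → Bool) :
    (fun b : ZMod L → Bool => ∏ x, if b x = a x then (1 : ℂ) else 0) = Pi.single a 1 := by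
  ext b
  simp [Finset.prod_ite_zero, Pi.single_apply, funext_iff]

/-- A coordinate projection is the sum of the projections onto its basis vectors. -/
lemma diagonal_ite_eq_sum_outer {ι : Type*} [Fintype ι] [DecidableEq ι]
    (p : ι → Prop) [DecidablePred p] :
    diagonal (fun b => if p b then (1 : ℂ) else 0) =
      ∑ a ∈ Finset.univ.filter p, outer (Pi.single a (1 : ℂ)) := by
  ext b b'
  simp only [Matrix.sum_apply, outer, Matrix.of_apply, Pi.single_apply, Matrix.diagonal_apply,
    Finset.sum_filter]
  rw [Finset.sum_eq_single b (fun a _ hab => by simp [hab.symm]) (by simp)]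
  by_cases h : b = b'
  · simp [h]
  · simp [h, Ne.symm h]

/-- For even `L`, the normalized projection `ρ₀ = P / Tr P` onto the zero-charge sector
(bit strings with exactly `L/2` ones) is a density operator that is strongly `U(1)`
symmetric at zero charge (`Qρ₀ = 0`), weakly translation symmetric (`Tρ₀T† = ρ₀`), and
fully separable as a mixture of site-wise product states. -/
theorem half_filling_projector_is_fully_separable
    (L : ℕ) [NeZero L] (hL : 2 ≤ L) (hLe : Even L)
    (P : Matrix (ZMod L → Bool) (ZMod L → Bool) ℂ)
    (hP : P = Matrix.diagonal fun b =>
      if 2 * (Finset.univ.filter fun x => b x).card = L then 1 else 0)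
    (ρ : Matrix (ZMod L → Bool) (ZMod L → Bool) ℂ)
    (hρ : ρ = (P.trace)⁻¹ • P) :
    ρ.PosSemidef ∧ ρ.trace = 1 ∧ chargeQ L * ρ = 0 ∧ transT L * ρ * (transT L)ᴴ = ρ ∧
      ∃ (n : ℕ) (p : Fin n → ℝ) (f : Fin n → ZMod L → Bool → ℂ),
        (∀ i, 0 < p i) ∧
        ρ = ∑ i, (p i : ℂ) • outer (fun b => ∏ x : ZMod L, f i x (b x)) := by
  set S : Finset (ZMod L → Bool) :=
    Finset.univ.filter fun b => 2 * (Finset.univ.filter fun x => b x).card = L with hS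
  have htr : P.trace = S.card := by
    simp [hP, Matrix.trace_diagonal, hS]
  have hcard : 0 < S.card := by
    obtain ⟨b, hb⟩ := exists_half_filled L hLe
    exact Finset.card_pos.mpr ⟨b, by simpa [hS] using hb⟩
  have hne : (S.card : ℂ) ≠ 0 := by exact_mod_cast hcard.ne'
  rw [htr] at hρ
  refine ⟨?_, ?_, ?_, ?_, S.card, fun _ => (S.card : ℝ)⁻¹,
    fun i x s => if s = (S.equivFin.symm i).1 x then 1 else 0, ?_, ?_⟩
  · rw [hρ, hP]
    refine (Matrix.PosSemidef.diagonal fun b => ?_).smul (by positivity)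
    dsimp only [Pi.zero_apply]
    split_ifs <;> simp
  · rw [hρ, Matrix.trace_smul, htr, smul_eq_mul, inv_mul_cancel₀ hne]
  · rw [hρ, hP, Matrix.mul_smul, chargeQ, Matrix.diagonal_mul_diagonal]
    convert smul_zero _
    rw [← Matrix.diagonal_zero]
    congr 1
    ext b
    split_ifs with hb
    · rw [sum_sign_eq_zero hb, zero_mul]
    · rw [mul_zero]
  · rw [hρ, hP, Matrix.mul_smul, Matrix.smul_mul, transT_mul_diagonal_mul_conjTranspose]
    simp only [card_filter_shift]
  · intro i
    positivity
  · rw [hρ, hP, diagonal_ite_eq_sum_outer, ← hS, ← Finset.smul_sum]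
    simp only [prod_ite_eq_single]
    rw [Equiv.sum_comp S.equivFin.symm fun a => outer (Pi.single a.1 (1 : ℂ)),
      Finset.sum_coe_sort S fun a => outer (Pi.single a (1 : ℂ))]
    push_cast
    rfl
end
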